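/- Let 0 < α < 1, h ≥ 0, T > 0, τ > 0, let f : [0,T] × ℝ × ℝ → ℝ be continuous, let g : [0,T] → [−h,T] be continuous with g(t) ≤ t, let φ : [−h,0] → ℝ be continuous, and suppose |f(t,υ₁,ϑ₁) − f(t,υ₂,ϑ₂)| ≤ L(|υ₁ − υ₂| + |ϑ₁ − ϑ₂|) for all υᵢ,ϑᵢ ∈ ℝ, t ∈ [0,T], with L > 0. Define the operator F on C([−h,T],ℝ) by (Fυ)(t) = φ(t) for t ∈ [−h,0] and (Fυ)(t) = φ(0) + (1/Γ(α)) ∫₀ᵗ (t−s)^{α−1} f(s, υ(s), υ(g(s))) ds for t ∈ [0,T]. Then for all continuous υ, ϑ : [−h,T] → ℝ one has ‖Fυ − Fϑ‖_B ≤ (2L/τ^α) ‖υ − ϑ‖_B; in particular, if τ is chosen so large that 2L/τ^α < 1, then F is a contraction on C([−h,T],ℝ) with the Bielecki norm. -/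

import Mathlib

open Real Set

/-- The truncated Laplace transform of `x ^ (α - 1)` is at most the full one, `Γ(α) / τ ^ α`. -/
theorem integral_sub_rpow_mul_exp_le {α τ t : ℝ} (hα : 0 < α) (hτ : 0 < τ) (ht : 0 ≤ t) :
    ∫ s in (0:ℝ)..t, (t - s) ^ (α - 1) * Real.exp (-(τ * (t - s))) ≤
      Real.Gamma α / τ ^ α := by
  rw [intervalIntegral.integral_comp_sub_left
    (fun x => x ^ (α - 1) * Real.exp (-(τ * x))) t, sub_self, sub_zero,
    intervalIntegral.integral_of_le ht]
  have key := Real.integral_rpow_mul_exp_neg_mul_Ioi hα hτ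
  have hpos : 0 < (1 / τ) ^ α * Real.Gamma α :=
    mul_pos (Real.rpow_pos_of_pos (by positivity) _) (Real.Gamma_pos_of_pos hα)
  have hint : MeasureTheory.IntegrableOn (fun x => x ^ (α - 1) * Real.exp (-(τ * x)))
      (Ioi (0:ℝ)) := by
    by_contra hn
    rw [MeasureTheory.integral_undef hn] at key
    exact hpos.ne key
  calc _ ≤ ∫ x in Ioi (0:ℝ), x ^ (α - 1) * Real.exp (-(τ * x)) := by
        refine MeasureTheory.setIntegral_mono_set hint ?_ Ioc_subset_Ioi_self.eventuallyLE
        filter_upwards [MeasureTheory.ae_restrict_mem measurableSet_Ioi] with x hx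
        exact mul_nonneg (Real.rpow_nonneg (le_of_lt hx) _) (Real.exp_pos _).le
    _ = Real.Gamma α / τ ^ α := by
        rw [key, Real.div_rpow zero_le_one hτ.le, Real.one_rpow]
        ring

/-- The weakly singular kernel `(t - s) ^ (α - 1)` times a continuous function is integrable. -/
theorem intervalIntegrable_sub_rpow_mul {α t : ℝ} (hα : 0 < α) (ht : 0 ≤ t) {u : ℝ → ℝ}
    (hu : ContinuousOn u (Icc 0 t)) :
    IntervalIntegrable (fun s => (t - s) ^ (α - 1) * u s) MeasureTheory.volume 0 t := by
  have h1 : IntervalIntegrable (fun x : ℝ => x ^ (α - 1)) MeasureTheory.volume t 0 :=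
    intervalIntegral.intervalIntegrable_rpow' (by linarith)
  have h2 := h1.comp_sub_left t
  rw [sub_self, sub_zero] at h2
  exact h2.mul_continuousOn (by rwa [uIcc_of_le ht])

/-- Weighted bound for a weakly singular integral whose density grows at most like `exp (τ s)`. -/
theorem abs_integral_sub_rpow_mul_le {α τ t C : ℝ} (hα : 0 < α) (hτ : 0 < τ) (ht : 0 ≤ t)
    (hC : 0 ≤ C) {u : ℝ → ℝ} (hbound : ∀ s ∈ Icc 0 t, |u s| ≤ C * Real.exp (τ * s)) :
    |∫ s in (0:ℝ)..t, (t - s) ^ (α - 1) * u s| * Real.exp (-τ * t) ≤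
      C * (Real.Gamma α / τ ^ α) := by
  have hle : |∫ s in (0:ℝ)..t, (t - s) ^ (α - 1) * u s| ≤
      ∫ s in (0:ℝ)..t, (t - s) ^ (α - 1) * (C * Real.exp (τ * s)) := by
    rw [← Real.norm_eq_abs]
    refine intervalIntegral.norm_integral_le_of_norm_le ht (Filter.Eventually.of_forall ?_)
      (intervalIntegrable_sub_rpow_mul hα ht (by fun_prop))
    intro s hs
    have hk : 0 ≤ (t - s) ^ (α - 1) := Real.rpow_nonneg (by linarith [hs.2]) _
    rw [norm_mul, Real.norm_of_nonneg hk, Real.norm_eq_abs]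
    exact mul_le_mul_of_nonneg_left (hbound s (Ioc_subset_Icc_self hs)) hk
  calc _ ≤ (∫ s in (0:ℝ)..t, (t - s) ^ (α - 1) * (C * Real.exp (τ * s))) *
          Real.exp (-τ * t) := by gcongr
    _ = C * ∫ s in (0:ℝ)..t, (t - s) ^ (α - 1) * Real.exp (-(τ * (t - s))) := by
        rw [← intervalIntegral.integral_mul_const, ← intervalIntegral.integral_const_mul]
        congr 1
        ext s
        rw [show -(τ * (t - s)) = τ * s + -τ * t by ring, Real.exp_add]
        ring
    _ ≤ _ := by gcongr; exact integral_sub_rpow_mul_exp_le hα hτ ht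

open Real Set

theorem bielecki_contraction_FDDE
    (α h T L τ : ℝ) (hα0 : 0 < α) (hα1 : α < 1) (hh : 0 ≤ h) (hT : 0 < T)
    (hL : 0 < L) (hτ : 0 < τ)
    (f : ℝ → ℝ → ℝ → ℝ) (g φ : ℝ → ℝ)
    (hf : ContinuousOn (fun p : ℝ × ℝ × ℝ => f p.1 p.2.1 p.2.2)
      (Set.Icc 0 T ×ˢ (Set.univ : Set (ℝ × ℝ))))
    (hg : ContinuousOn g (Set.Icc 0 T))
    (hgmem : ∀ t ∈ Set.Icc (0:ℝ) T, g t ∈ Set.Icc (-h) T)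
    (hgle : ∀ t ∈ Set.Icc (0:ℝ) T, g t ≤ t)
    (hφ : ContinuousOn φ (Set.Icc (-h) 0))
    (hLip : ∀ t ∈ Set.Icc (0:ℝ) T, ∀ υ₁ υ₂ ϑ₁ ϑ₂ : ℝ,
      |f t υ₁ ϑ₁ - f t υ₂ ϑ₂| ≤ L * (|υ₁ - υ₂| + |ϑ₁ - ϑ₂|))
    (F : (ℝ → ℝ) → (ℝ → ℝ))
    (hF : ∀ υ : ℝ → ℝ, ContinuousOn υ (Set.Icc (-h) T) →
      (∀ t ∈ Set.Icc (-h) (0:ℝ), F υ t = φ t) ∧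
      (∀ t ∈ Set.Icc (0:ℝ) T, F υ t = φ 0 +
        (1 / Real.Gamma α) * ∫ s in (0:ℝ)..t, (t - s) ^ (α - 1) * f s (υ s) (υ (g s)))) :
    ∀ υ ϑ : ℝ → ℝ, ContinuousOn υ (Set.Icc (-h) T) → ContinuousOn ϑ (Set.Icc (-h) T) →
      (⨆ t : Set.Icc (-h) T, |F υ ↑t - F ϑ ↑t| * Real.exp (-τ * ↑t)) ≤
        (2 * L / τ ^ α) * ⨆ t : Set.Icc (-h) T, |υ ↑t - ϑ ↑t| * Real.exp (-τ * ↑t) := by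
  intro υ ϑ hυ hϑ
  set M := ⨆ t : Set.Icc (-h) T, |υ ↑t - ϑ ↑t| * Real.exp (-τ * ↑t) with hM
  have hbdd : BddAbove (range fun t : Set.Icc (-h) T =>
      |υ ↑t - ϑ ↑t| * Real.exp (-τ * ↑t)) := by
    have hc : ContinuousOn (fun t => |υ t - ϑ t| * Real.exp (-τ * t)) (Icc (-h) T) :=
      (hυ.sub hϑ).abs.mul (by fun_prop)
    have := isCompact_Icc.bddAbove_image hc
    rwa [image_eq_range] at this
  have hM0 : 0 ≤ M := Real.iSup_nonneg fun t => by positivity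
  have hdiff : ∀ s ∈ Icc (-h) T, |υ s - ϑ s| ≤ M * Real.exp (τ * s) := by
    intro s hs
    have := le_ciSup hbdd ⟨s, hs⟩
    calc |υ s - ϑ s| = |υ s - ϑ s| * Real.exp (-τ * s) * Real.exp (τ * s) := by
          rw [mul_assoc, ← Real.exp_add]; simp
      _ ≤ M * Real.exp (τ * s) := by gcongr
  have hsub : Icc 0 T ⊆ Icc (-h) T := Icc_subset_Icc_left (by linarith)
  have hcont : ∀ w : ℝ → ℝ, ContinuousOn w (Icc (-h) T) →
      ContinuousOn (fun s => f s (w s) (w (g s))) (Icc 0 T) := fun w hw =>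
    hf.comp (f := fun s => (s, w s, w (g s)))
      (continuousOn_id.prodMk ((hw.mono hsub).prodMk (hw.comp hg hgmem)))
      fun s hs => ⟨hs, mem_univ _⟩
  have hτα : 0 < τ ^ α := Real.rpow_pos_of_pos hτ _
  have hΓ : 0 < Real.Gamma α := Real.Gamma_pos_of_pos hα0
  have : Nonempty (Icc (-h) T) := ⟨⟨0, by linarith, hT.le⟩⟩
  refine ciSup_le ?_
  rintro ⟨t, ht⟩
  change |F υ t - F ϑ t| * Real.exp (-τ * t) ≤ _
  rcases le_total t 0 with h0 | h0
  · rw [(hF υ hυ).1 t ⟨ht.1, h0⟩, (hF ϑ hϑ).1 t ⟨ht.1, h0⟩]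
    simp only [sub_self, abs_zero, zero_mul]
    positivity
  have htT : Icc 0 t ⊆ Icc 0 T := Icc_subset_Icc_right ht.2
  have hFsub : F υ t - F ϑ t = 1 / Real.Gamma α * ∫ s in (0:ℝ)..t,
      (t - s) ^ (α - 1) * (f s (υ s) (υ (g s)) - f s (ϑ s) (ϑ (g s))) := by
    rw [(hF υ hυ).2 t ⟨h0, ht.2⟩, (hF ϑ hϑ).2 t ⟨h0, ht.2⟩, add_sub_add_left_eq_sub,
      ← mul_sub, ← intervalIntegral.integral_sub
        (intervalIntegrable_sub_rpow_mul hα0 h0 ((hcont υ hυ).mono htT))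
        (intervalIntegrable_sub_rpow_mul hα0 h0 ((hcont ϑ hϑ).mono htT))]
    simp only [mul_sub]
  have hbound : ∀ s ∈ Icc 0 t, |f s (υ s) (υ (g s)) - f s (ϑ s) (ϑ (g s))| ≤
      2 * L * M * Real.exp (τ * s) := by
    intro s hs
    have hs' := htT hs
    have hdelay : |υ (g s) - ϑ (g s)| ≤ M * Real.exp (τ * s) :=
      (hdiff (g s) (hgmem s hs')).trans (by gcongr; exact hgle s hs')
    calc _ ≤ L * (|υ s - ϑ s| + |υ (g s) - ϑ (g s)|) := hLip s hs' _ _ _ _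
      _ ≤ L * (M * Real.exp (τ * s) + M * Real.exp (τ * s)) := by
          gcongr
          exact hdiff s (hsub hs')
      _ = 2 * L * M * Real.exp (τ * s) := by ring
  rw [hFsub, abs_mul, abs_of_pos (one_div_pos.mpr hΓ), mul_assoc]
  calc _ ≤ 1 / Real.Gamma α * (2 * L * M * (Real.Gamma α / τ ^ α)) := by
        refine mul_le_mul_of_nonneg_left ?_ (by positivity)
        exact abs_integral_sub_rpow_mul_le hα0 hτ h0 (by positivity) hbound
    _ = 2 * L / τ ^ α * M := by field_simp
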